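/- Cut-and-join differential equation for double Hurwitz numbers: for a positive integer d, define the cut-and-join coefficients (CJ)_{μ,ν} = z_ν · Σ_χ f_χ · χ(σ_μ) χ(σ_ν) / (z_μ z_ν), the sum over irreducible complex characters χ of S_d, for partitions μ, ν of d. Then for all partitions μ, ν of d and all λ ∈ ℂ, the function λ ↦ Φ•_{μ,ν}(λ) is differentiable and (d/dλ) Φ•_{μ,ν}(λ) = Σ_{η a partition of d} (CJ)_{μ,η} · Φ•_{η,ν}(λ) = Σ_{η a partition of d} Φ•_{μ,η}(λ) · (CJ)_{ν,η}. -/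

import Mathlib

open scoped BigOperators Classical

noncomputable section

namespace DoubleHurwitz

/-- The cycle type of a permutation of `{1, …, d}`, counting fixed points as cycles of
length 1 (Mathlib's `Equiv.Perm.cycleType` records only the nontrivial cycles). -/
def fullCycleType {d : ℕ} (σ : Equiv.Perm (Fin d)) : Multiset ℕ :=
  σ.cycleType + Multiset.replicate (d - σ.cycleType.sum) 1

/-- `σ` has cycle type `μ`, where fixed points count as cycles of length 1. -/
def HasCycleType {d : ℕ} (σ : Equiv.Perm (Fin d)) (μ : Nat.Partition d) : Prop :=
  fullCycleType σ = μ.parts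

/-- `z_μ = ∏_{j ≥ 1} m_j(μ)! · j^{m_j(μ)}` where `m_j(μ)` is the number of parts equal
to `j` (all parts lie in `{1, …, d}`). -/
def zPart {d : ℕ} (μ : Nat.Partition d) : ℕ :=
  ∏ j ∈ Finset.Icc 1 d, Nat.factorial (μ.parts.count j) * j ^ (μ.parts.count j)

/-- `χ : S_d → ℂ` is an irreducible (complex) character: the character of some simple
finite-dimensional complex representation of `S_d`. -/
def IsIrredChar (d : ℕ) (χ : Equiv.Perm (Fin d) → ℂ) : Prop :=
  ∃ V : FDRep ℂ (Equiv.Perm (Fin d)), CategoryTheory.Simple V ∧ χ = V.character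

/-- The (finite) type of irreducible complex characters of `S_d`. -/
def IrredChar (d : ℕ) : Type :=
  {χ : Equiv.Perm (Fin d) → ℂ // IsIrredChar d χ}

/-- `f_χ = (d(d−1)/2)·χ(t)/χ(1)` for any transposition `t`.  Since characters are class
functions and the `d(d−1)/2` transpositions form a single conjugacy class, this value
equals the sum of `χ(t)/χ(1)` over all transpositions `t`, which is how we encode it
(this avoids an arbitrary choice of transposition, and gives `0` when `d = 1`,
matching `d(d−1)/2 = 0`). -/
def fChar {d : ℕ} (χ : Equiv.Perm (Fin d) → ℂ) : ℂ :=
  ∑ t ∈ Finset.univ.filter (fun t : Equiv.Perm (Fin d) => t.IsSwap), χ t / χ 1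

/-- The disconnected double Hurwitz generating function
`Φ•_{μ,ν}(λ) = Σ_χ (χ(σ_μ)/z_μ)·(χ(σ_ν)/z_ν)·e^{f_χ λ}`, the sum ranging over the
irreducible complex characters of `S_d`, where `rep` is a choice of a permutation
`σ_μ = rep μ` of each cycle type `μ`. -/
def Phi {d : ℕ} (rep : Nat.Partition d → Equiv.Perm (Fin d)) (μ ν : Nat.Partition d)
    (lam : ℂ) : ℂ :=
  ∑ᶠ χ : IrredChar d,
    (χ.1 (rep μ) / zPart μ) * (χ.1 (rep ν) / zPart ν) * Complex.exp (fChar χ.1 * lam)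

end DoubleHurwitz

namespace DoubleHurwitz

lemma fullCycleType_eq_iff_isConj {d : ℕ} {σ τ : Equiv.Perm (Fin d)} :
    fullCycleType σ = fullCycleType τ ↔ IsConj σ τ := by
  rw [Equiv.Perm.isConj_iff_cycleType_eq]
  refine ⟨fun h => ?_, fun h => by simp only [fullCycleType, h]⟩
  have key (ρ : Equiv.Perm (Fin d)) :
      (fullCycleType ρ).filter (fun n => 2 ≤ n) = ρ.cycleType := by
    rw [fullCycleType, Multiset.filter_add,
      Multiset.filter_eq_self.2 fun _ => Equiv.Perm.two_le_of_mem_cycleType,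
      Multiset.filter_eq_nil.2 fun a ha => by rw [Multiset.eq_of_mem_replicate ha]; decide,
      add_zero]
  rw [← key σ, ← key τ, h]

/-- The partition of `d` given by the cycle type of a permutation. -/
def cyclePartition {d : ℕ} (σ : Equiv.Perm (Fin d)) : Nat.Partition d where
  parts := fullCycleType σ
  parts_pos {n hn} := by
    rcases Multiset.mem_add.mp hn with hn | hn
    · exact zero_lt_one.trans (Equiv.Perm.one_lt_of_mem_cycleType hn)
    · exact (Multiset.eq_of_mem_replicate hn).symm ▸ zero_lt_one
  parts_sum := by
    have h : σ.cycleType.sum ≤ d := by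
      simpa [Equiv.Perm.sum_cycleType] using Finset.card_le_univ σ.support
    simp only [fullCycleType, Multiset.sum_add, Multiset.sum_replicate, smul_eq_mul, mul_one]
    omega

lemma cyclePartition_eq_iff {d : ℕ} {σ τ : Equiv.Perm (Fin d)} {μ : Nat.Partition d}
    (hτ : HasCycleType τ μ) : cyclePartition σ = μ ↔ IsConj τ σ := by
  rw [Nat.Partition.ext_iff, ← hτ, isConj_comm, ← fullCycleType_eq_iff_isConj]
  rfl

lemma zPart_eq {d : ℕ} (hd : 0 < d) {σ : Equiv.Perm (Fin d)} {μ : Nat.Partition d}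
    (h : HasCycleType σ μ) :
    zPart μ = (d - σ.cycleType.sum).factorial * σ.cycleType.prod *
      ∏ n ∈ σ.cycleType.toFinset, (σ.cycleType.count n).factorial := by
  have hone : 1 ∉ σ.cycleType := fun h1 =>
    absurd (Equiv.Perm.two_le_of_mem_cycleType h1) (by decide)
  have hsub : insert 1 σ.cycleType.toFinset ⊆ Finset.Icc 1 d := by
    intro j hj
    rw [Finset.mem_insert, Multiset.mem_toFinset] at hj
    rw [Finset.mem_Icc]
    rcases hj with rfl | hj
    · omega
    · refine ⟨(Equiv.Perm.one_lt_of_mem_cycleType hj).le, ?_⟩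
      refine (Equiv.Perm.le_card_support_of_mem_cycleType hj).trans ?_
      simpa using Finset.card_le_univ σ.support
  rw [zPart, ← h, fullCycleType, ← Finset.prod_subset hsub,
    Finset.prod_insert (by simpa using hone)]
  · rw [Finset.prod_multiset_count σ.cycleType, one_pow, mul_one,
      mul_assoc (d - _).factorial, mul_comm (∏ m ∈ σ.cycleType.toFinset, m ^ _),
      ← Finset.prod_mul_distrib]
    congr 1
    · simp [Multiset.count_eq_zero_of_notMem hone]
    · refine Finset.prod_congr rfl fun j hj => ?_
      have hj1 : 1 ≠ j := fun e => hone (e ▸ Multiset.mem_toFinset.1 hj)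
      simp [Multiset.count_replicate, hj1]
  · intro j _ hj
    rw [Finset.mem_insert, not_or, Multiset.mem_toFinset] at hj
    simp [Multiset.count_replicate, Ne.symm hj.1, Multiset.count_eq_zero_of_notMem hj.2]

lemma card_isConj_mul_zPart {d : ℕ} (hd : 0 < d) {σ : Equiv.Perm (Fin d)} {μ : Nat.Partition d}
    (h : HasCycleType σ μ) :
    (Finset.univ.filter fun τ => IsConj σ τ).card * zPart μ = d.factorial := by
  have := Equiv.Perm.card_isConj_mul_eq σ
  rw [zPart_eq hd h]
  simpa [Nat.card_eq_fintype_card, Fintype.card_subtype] using this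

lemma zPart_ne_zero {d : ℕ} (μ : Nat.Partition d) : (zPart μ : ℂ) ≠ 0 := by
  rw [Nat.cast_ne_zero, zPart, Finset.prod_ne_zero_iff]
  intro j hj
  have := (Finset.mem_Icc.1 hj).1
  positivity

lemma IrredChar.apply_eq_of_isConj {d : ℕ} (χ : IrredChar d) {σ τ : Equiv.Perm (Fin d)}
    (h : IsConj σ τ) : χ.1 σ = χ.1 τ := by
  obtain ⟨V, -, hV⟩ := χ.2
  obtain ⟨c, rfl⟩ := isConj_iff.1 h
  rw [hV, FDRep.char_conj]

lemma IrredChar.sum_mul {d : ℕ} (χ ψ : IrredChar d) :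
    ∑ σ, χ.1 σ * ψ.1 σ = if χ = ψ then (d.factorial : ℂ) else 0 := by
  obtain ⟨V, _, hV⟩ := χ.2
  obtain ⟨W, _, hW⟩ := ψ.2
  have hcard : (Nat.card (Equiv.Perm (Fin d)) : ℂ) = d.factorial := by
    simp [Nat.card_eq_fintype_card, Fintype.card_perm]
  have hne : (d.factorial : ℂ) ≠ 0 := Nat.cast_ne_zero.2 d.factorial_ne_zero
  let : Invertible (Nat.card (Equiv.Perm (Fin d)) : ℂ) := invertibleOfNonzero (hcard ▸ hne)
  have hinv (σ : Equiv.Perm (Fin d)) : ψ.1 σ = W.character σ⁻¹ := by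
    rw [← hW]
    exact ψ.apply_eq_of_isConj
      (Equiv.Perm.isConj_of_cycleType_eq (Equiv.Perm.cycleType_inv σ).symm)
  split_ifs with h
  · subst h
    have key := FDRep.char_orthonormal V V
    rw [if_pos ⟨CategoryTheory.Iso.refl V⟩, hcard, inv_mul_eq_one₀ hne] at key
    rw [key]
    refine Finset.sum_congr rfl fun σ _ => ?_
    rw [← hV, hinv σ, ← hW, hV]
  · have key := FDRep.char_orthonormal V W
    rw [if_neg fun ⟨i⟩ => h (Subtype.ext (by rw [hV, hW, FDRep.char_iso i])), hcard,
      mul_eq_zero, or_iff_right (inv_ne_zero hne)] at key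
    rw [← key]
    exact Finset.sum_congr rfl fun σ _ => by rw [hinv, hV]

instance (d : ℕ) : Finite (IrredChar d) := by
  have hli : LinearIndependent ℂ (fun χ : IrredChar d => χ.1) := by
    rw [linearIndependent_iff']
    intro s c hc χ hχ
    have h0 : ∑ σ, (∑ ψ ∈ s, c ψ • ψ.1) σ * χ.1 σ = 0 := by
      rw [hc]
      simp
    simp only [Finset.sum_apply, Pi.smul_apply, smul_eq_mul, Finset.sum_mul, mul_assoc] at h0
    rw [Finset.sum_comm] at h0
    simp only [← Finset.mul_sum, IrredChar.sum_mul] at h0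
    simpa [hχ, Nat.factorial_ne_zero] using h0
  exact hli.finite

lemma IrredChar.sum_partition_mul {d : ℕ} (hd : 0 < d)
    {rep : Nat.Partition d → Equiv.Perm (Fin d)}
    (hrep : ∀ μ : Nat.Partition d, HasCycleType (rep μ) μ) (χ ψ : IrredChar d) :
    ∑ η : Nat.Partition d, χ.1 (rep η) * ψ.1 (rep η) / (zPart η : ℂ) =
      if χ = ψ then 1 else 0 := by
  have hne : (d.factorial : ℂ) ≠ 0 := Nat.cast_ne_zero.2 d.factorial_ne_zero
  have key := χ.sum_mul ψ
  rw [← Finset.sum_fiberwise Finset.univ cyclePartition] at key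
  have hfib (η : Nat.Partition d) :
      ∑ σ with cyclePartition σ = η, χ.1 σ * ψ.1 σ =
        d.factorial * (χ.1 (rep η) * ψ.1 (rep η) / (zPart η : ℂ)) := by
    rw [Finset.sum_congr rfl (g := fun _ => χ.1 (rep η) * ψ.1 (rep η)), Finset.sum_const,
      ← card_isConj_mul_zPart hd (hrep η)]
    · simp only [cyclePartition_eq_iff (hrep η), nsmul_eq_mul, Nat.cast_mul]
      field_simp [zPart_ne_zero η]
    · intro σ hσ
      have hc := (cyclePartition_eq_iff (hrep η)).1 (Finset.mem_filter.1 hσ).2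
      rw [χ.apply_eq_of_isConj hc, ψ.apply_eq_of_isConj hc]
  simp only [hfib, ← Finset.mul_sum] at key
  apply mul_left_cancel₀ hne
  rw [key]
  split_ifs <;> simp

lemma Phi_comm {d : ℕ} (rep : Nat.Partition d → Equiv.Perm (Fin d)) (μ ν : Nat.Partition d)
    (lam : ℂ) : Phi rep μ ν lam = Phi rep ν μ lam :=
  finsum_congr fun _ => by ring

lemma hasDerivAt_Phi {d : ℕ} (rep : Nat.Partition d → Equiv.Perm (Fin d))
    (μ ν : Nat.Partition d) (lam : ℂ) :
    HasDerivAt (fun l => Phi rep μ ν l)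
      (∑ᶠ χ : IrredChar d, (χ.1 (rep μ) / zPart μ) * (χ.1 (rep ν) / zPart ν) *
        (fChar χ.1 * Complex.exp (fChar χ.1 * lam))) lam := by
  let := Fintype.ofFinite (IrredChar d)
  simp only [Phi, finsum_eq_sum_of_fintype]
  refine HasDerivAt.fun_sum fun χ _ => HasDerivAt.const_mul _ ?_
  simpa [mul_comm] using ((hasDerivAt_id lam).const_mul (fChar χ.1)).cexp

/-- Multiplying by the cut-and-join matrix inserts a factor `f_χ` into the character sum. -/
lemma sum_cutAndJoin_mul_Phi {d : ℕ} (hd : 0 < d)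
    {rep : Nat.Partition d → Equiv.Perm (Fin d)}
    (hrep : ∀ μ : Nat.Partition d, HasCycleType (rep μ) μ) (μ ν : Nat.Partition d) (lam : ℂ) :
    ∑ η : Nat.Partition d, ((zPart η : ℂ) * ∑ᶠ χ : IrredChar d,
        fChar χ.1 * χ.1 (rep μ) * χ.1 (rep η) / ((zPart μ : ℂ) * (zPart η : ℂ))) *
          Phi rep η ν lam =
      ∑ᶠ χ : IrredChar d, (χ.1 (rep μ) / zPart μ) * (χ.1 (rep ν) / zPart ν) *
        (fChar χ.1 * Complex.exp (fChar χ.1 * lam)) := by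
  let := Fintype.ofFinite (IrredChar d)
  have hterm (η : Nat.Partition d) : ((zPart η : ℂ) * ∑ χ : IrredChar d,
        fChar χ.1 * χ.1 (rep μ) * χ.1 (rep η) / ((zPart μ : ℂ) * (zPart η : ℂ))) *
          Phi rep η ν lam =
      ∑ χ : IrredChar d, ∑ ψ : IrredChar d,
        (fChar χ.1 * (χ.1 (rep μ) / zPart μ) * (ψ.1 (rep ν) / zPart ν) *
          Complex.exp (fChar ψ.1 * lam)) * (χ.1 (rep η) * ψ.1 (rep η) / (zPart η : ℂ)) := by
    rw [Phi, finsum_eq_sum_of_fintype, mul_assoc, Finset.sum_mul_sum, Finset.mul_sum]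
    refine Finset.sum_congr rfl fun χ _ => ?_
    rw [Finset.mul_sum]
    refine Finset.sum_congr rfl fun ψ _ => ?_
    have := zPart_ne_zero η
    field_simp
  simp only [finsum_eq_sum_of_fintype, hterm]
  rw [Finset.sum_comm]
  refine Finset.sum_congr rfl fun χ _ => ?_
  rw [Finset.sum_comm]
  simp only [← Finset.mul_sum, IrredChar.sum_partition_mul hd hrep]
  simp only [mul_ite, mul_one, mul_zero, Finset.sum_ite_eq, Finset.mem_univ, if_true]
  ring

end DoubleHurwitz

open DoubleHurwitz in
/-- **Cut-and-join differential equation for double Hurwitz numbers.** -/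
theorem cut_and_join_ODE (d : ℕ) (hd : 0 < d)
    (rep : Nat.Partition d → Equiv.Perm (Fin d))
    (hrep : ∀ μ : Nat.Partition d, HasCycleType (rep μ) μ)
    (CJ : Nat.Partition d → Nat.Partition d → ℂ)
    (hCJ : ∀ μ ν : Nat.Partition d, CJ μ ν = (zPart ν : ℂ) *
        ∑ᶠ χ : IrredChar d,
          fChar χ.1 * χ.1 (rep μ) * χ.1 (rep ν) / ((zPart μ : ℂ) * (zPart ν : ℂ)))
    (μ ν : Nat.Partition d) (lam : ℂ) :
    HasDerivAt (fun l => Phi rep μ ν l)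
      (∑ η : Nat.Partition d, CJ μ η * Phi rep η ν lam) lam ∧
    ∑ η : Nat.Partition d, CJ μ η * Phi rep η ν lam
      = ∑ η : Nat.Partition d, Phi rep μ η lam * CJ ν η := by
  have h (μ ν : Nat.Partition d) := sum_cutAndJoin_mul_Phi hd hrep μ ν lam
  simp only [← hCJ] at h
  refine ⟨h μ ν ▸ hasDerivAt_Phi rep μ ν lam, ?_⟩
  have hr : ∑ η : Nat.Partition d, Phi rep μ η lam * CJ ν η =
      ∑ η : Nat.Partition d, CJ ν η * Phi rep η μ lam :=
    Finset.sum_congr rfl fun η _ => by rw [Phi_comm, mul_comm]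
  rw [hr, h μ ν, h ν μ]
  exact finsum_congr fun _ => by ring
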